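/- arXiv:1910.09416 — 7 statements merged into one kernel-verified Lean document; each statement's English description precedes it below -/
import Mathlib

section
/- Let n be a positive integer and M a positive integer with a := M/2^n ≤ 1/2. Then every code A ⊆ {-1,1}^n with |A| = M satisfies D(A) ≥ n/2 − φ(a). -/
/-- The average Hamming distance of a code `A`. -/
noncomputable def avgDist {n : ℕ} (A : Finset (Fin n → ℤ)) : ℝ :=
  ((A.card : ℝ) ^ 2)⁻¹ * ∑ x ∈ A, ∑ y ∈ A, (hammingDist x y : ℝ)

/-- `φ(a) = 1/√a − 1` for `0 < a ≤ 1/4` and `φ(a) = 1/(4a)` for `1/4 < a ≤ 1/2`. -/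
noncomputable def phi (a : ℝ) : ℝ :=
  if a ≤ 1 / 4 then 1 / Real.sqrt a - 1 else 1 / (4 * a)

open Finset in
/-- The unnormalized Fourier coefficient of the indicator function of `A` at `S`. -/
noncomputable def codeCoeff {n : ℕ} (A : Finset (Fin n → ℤ)) (S : Finset (Fin n)) : ℝ :=
  ∑ x ∈ A, ∏ i ∈ S, (x i : ℝ)

open Finset in
theorem sum_prod_one_add_eq_sum_codeCoeff {n : ℕ} (A : Finset (Fin n → ℤ)) (t : ℝ) :
    ∑ x ∈ A, ∑ y ∈ A, ∏ i, (1 + t * ((x i : ℝ) * y i)) =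
      ∑ S : Finset (Fin n), t ^ #S * codeCoeff A S ^ 2 := by
  simp_rw [prod_one_add, powerset_univ, codeCoeff, sq, sum_mul_sum, mul_sum, prod_mul_distrib,
    prod_const]
  conv_rhs => rw [sum_comm]
  refine sum_congr rfl fun x _ => ?_
  rw [sum_comm]

open Finset in
theorem sum_prod_one_add_mul_eq {n : ℕ} (A : Finset (Fin n → ℤ))
    (hA : ∀ x ∈ A, ∀ i, x i = -1 ∨ x i = 1) :
    ∑ x ∈ A, ∑ y ∈ A, ∏ i, (1 + 1 * ((x i : ℝ) * y i)) = 2 ^ n * #A := by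
  have key : ∀ x ∈ A, ∑ y ∈ A, ∏ i, (1 + 1 * ((x i : ℝ) * y i)) = 2 ^ n := by
    intro x hx
    rw [sum_eq_single_of_mem x hx]
    · have : ∀ i, 1 + 1 * ((x i : ℝ) * x i) = 2 := fun i => by
        rcases hA x hx i with h | h <;> rw [h] <;> norm_num
      rw [prod_congr rfl fun i _ => this i]
      simp
    · intro y hy hyx
      obtain ⟨i, hi⟩ := Function.ne_iff.mp hyx
      refine prod_eq_zero (mem_univ i) ?_
      rcases hA x hx i with h | h <;> rcases hA y hy i with h' | h' <;> simp_all
  rw [sum_congr rfl key]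
  simp [mul_comm]

open Finset in
theorem sum_prod_one_sub_nonneg {n : ℕ} (A : Finset (Fin n → ℤ))
    (hA : ∀ x ∈ A, ∀ i, x i = -1 ∨ x i = 1) {r : ℝ} (hr0 : 0 ≤ r) (hr1 : r ≤ 1) :
    0 ≤ ∑ x ∈ A, ∑ y ∈ A, ∏ i, (1 + -r * ((x i : ℝ) * y i)) := by
  refine sum_nonneg fun x hx => sum_nonneg fun y hy => prod_nonneg fun i _ => ?_
  rcases hA x hx i with h | h <;> rcases hA y hy i with h' | h' <;> rw [h, h'] <;> push_cast <;>
    linarith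

theorem neg_pow_sub_sq_le {r : ℝ} (hr0 : 0 ≤ r) (hr1 : r ≤ 1) (k : ℕ) :
    (-r) ^ k - r ^ 2 ≤
      (if k = 0 then 1 - r ^ 2 else 0) - (if k = 1 then r + r ^ 2 else 0) := by
  match k with
  | 0 => simp
  | 1 => simp; linarith
  | k + 2 =>
    have h : (-r) ^ (k + 2) ≤ r ^ 2 := by
      calc (-r) ^ (k + 2) ≤ |(-r) ^ (k + 2)| := le_abs_self _
        _ = r ^ (k + 2) := by rw [abs_pow, abs_neg, abs_of_nonneg hr0]
        _ ≤ r ^ 2 := pow_le_pow_of_le_one hr0 hr1 (by omega)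
    simpa using h

open Finset in
theorem sum_codeCoeff_singleton_sq_le {n : ℕ} (A : Finset (Fin n → ℤ))
    (hA : ∀ x ∈ A, ∀ i, x i = -1 ∨ x i = 1) {r : ℝ} (hr0 : 0 ≤ r) (hr1 : r ≤ 1) :
    (r + r ^ 2) * ∑ i, codeCoeff A {i} ^ 2 ≤ (1 - r ^ 2) * (#A : ℝ) ^ 2 + r ^ 2 * (2 ^ n * #A) := by
  have h0 := sum_prod_one_sub_nonneg A hA hr0 hr1
  have h1 := sum_prod_one_add_mul_eq A hA
  rw [sum_prod_one_add_eq_sum_codeCoeff] at h0 h1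
  simp only [one_pow, one_mul] at h1
  have h2 : ∑ S : Finset (Fin n), ((-r) ^ #S - r ^ 2) * codeCoeff A S ^ 2 ≤
      ∑ S : Finset (Fin n), ((if #S = 0 then 1 - r ^ 2 else 0) -
        (if #S = 1 then r + r ^ 2 else 0)) * codeCoeff A S ^ 2 :=
    sum_le_sum fun S _ =>
      mul_le_mul_of_nonneg_right (neg_pow_sub_sq_le hr0 hr1 _) (sq_nonneg _)
  have h3 : ∑ S : Finset (Fin n), (if #S = 0 then 1 - r ^ 2 else 0) * codeCoeff A S ^ 2 =
      (1 - r ^ 2) * (#A : ℝ) ^ 2 := by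
    rw [sum_eq_single_of_mem ∅ (mem_univ _) (fun S _ hS => by simp [hS])]
    simp [codeCoeff]
  have h4 : ∑ S : Finset (Fin n), (if #S = 1 then r + r ^ 2 else 0) * codeCoeff A S ^ 2 =
      (r + r ^ 2) * ∑ i, codeCoeff A {i} ^ 2 := by
    simp_rw [ite_mul, zero_mul]
    rw [← sum_filter, ← mul_sum, univ_filter_card_eq, powersetCard_one, sum_map]
    rfl
  simp only [sub_mul, sum_sub_distrib] at h2
  rw [h3, h4, ← mul_sum, h1] at h2
  linarith

open Finset in
theorem sum_hammingDist_eq {n : ℕ} (A : Finset (Fin n → ℤ))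
    (hA : ∀ x ∈ A, ∀ i, x i = -1 ∨ x i = 1) :
    ∑ x ∈ A, ∑ y ∈ A, (hammingDist x y : ℝ) =
      (n * (#A : ℝ) ^ 2 - ∑ i, codeCoeff A {i} ^ 2) / 2 := by
  have key : ∀ x ∈ A, ∀ y ∈ A, (hammingDist x y : ℝ) = (n - ∑ i, (x i : ℝ) * y i) / 2 := by
    intro x hx y hy
    have h : ∀ i, (if x i ≠ y i then (1 : ℝ) else 0) = (1 - (x i : ℝ) * y i) / 2 := fun i => by
      rcases hA x hx i with h | h <;> rcases hA y hy i with h' | h' <;> rw [h, h'] <;> norm_num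
    rw [hammingDist, card_filter]
    push_cast
    rw [sum_congr rfl fun i _ => h i, ← sum_div, sum_sub_distrib]
    simp
  rw [sum_congr rfl fun x hx => sum_congr rfl fun y hy => key x hx y hy]
  simp_rw [← sum_div, sum_sub_distrib, codeCoeff, prod_singleton, sq, sum_mul_sum]
  rw [sum_comm (s := univ)]
  simp_rw [sum_comm (s := univ)]
  simp
  ring

theorem avgDist_ge (n M : ℕ) (hn : 0 < n) (hM : 0 < M)
    (ha : (M : ℝ) / 2 ^ n ≤ 1 / 2)
    (A : Finset (Fin n → ℤ))
    (hApm : ∀ x ∈ A, ∀ i, x i = -1 ∨ x i = 1)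
    (hAcard : A.card = M) :
    avgDist A ≥ (n : ℝ) / 2 - phi ((M : ℝ) / 2 ^ n) := by
  have hM' : (0 : ℝ) < M := by exact_mod_cast hM
  set a : ℝ := (M : ℝ) / 2 ^ n with ha_def
  have ha0 : 0 < a := by positivity
  have hN : (2 : ℝ) ^ n = M / a := by rw [ha_def]; field_simp
  have hD : avgDist A = n / 2 - (∑ i, codeCoeff A {i} ^ 2) / (2 * (M : ℝ) ^ 2) := by
    rw [avgDist, sum_hammingDist_eq A hApm, hAcard]
    field_simp
  have hbound : ∀ r : ℝ, 0 < r → r ≤ 1 →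
      (∑ i, codeCoeff A {i} ^ 2) / (2 * (M : ℝ) ^ 2) ≤
        ((1 - r ^ 2) + r ^ 2 / a) / (2 * (r + r ^ 2)) := by
    intro r hr0 hr1
    have h := sum_codeCoeff_singleton_sq_le A hApm hr0.le hr1
    rw [hAcard, hN] at h
    rw [div_le_div_iff₀ (by positivity) (by positivity)]
    have e : (1 - r ^ 2) * (M : ℝ) ^ 2 + r ^ 2 * (M / a * M) =
        ((1 - r ^ 2) + r ^ 2 / a) * (M : ℝ) ^ 2 := by ring
    linarith
  rw [hD, ge_iff_le, sub_le_sub_iff_left, phi]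
  split_ifs with h4
  · obtain ⟨s, hs0, hs⟩ : ∃ s : ℝ, 0 < s ∧ a = s ^ 2 :=
      ⟨Real.sqrt a, Real.sqrt_pos.mpr ha0, (Real.sq_sqrt ha0.le).symm⟩
    have hs2 : s ≤ 1 / 2 := by nlinarith
    have hs1 : 0 < 1 - s := by linarith
    refine (hbound (s / (1 - s)) (by positivity) ((div_le_one hs1).mpr (by linarith))).trans_eq ?_
    have e : s / (1 - s) + (s / (1 - s)) ^ 2 = s / (1 - s) ^ 2 := by field_simp; ring
    rw [e, hs, Real.sqrt_sq hs0.le]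
    field_simp
    ring
  · refine (hbound 1 one_pos le_rfl).trans_eq ?_
    field_simp
    norm_num
end

section
/- Let n and M be positive integers with M ≤ 2^{n-1}, and let k be a nonnegative integer. Then (min over all A ⊆ {-1,1}^{n+k} with |A| = 2^k·M of D(A)) − k/2 ≤ (min over all A ⊆ {-1,1}^n with |A| = M of D(A)). -/
/-- The set of average distances of codes in `{-1,1}^n` of cardinality `M`. -/
def avgDistSet (n M : ℕ) : Set ℝ :=
  {d : ℝ | ∃ A : Finset (Fin n → ℤ),
    (∀ x ∈ A, ∀ i, x i = -1 ∨ x i = 1) ∧ A.card = M ∧ d = avgDist A}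

theorem hammingDist_cons {n : ℕ} {α : Type*} [DecidableEq α] (a b : α) (x y : Fin n → α) :
    hammingDist (Fin.cons a x : Fin (n + 1) → α) (Fin.cons b y) =
      (if a = b then 0 else 1) + hammingDist x y := by
  simp only [hammingDist, Finset.card_filter, Fin.sum_univ_succ, Fin.cons_zero, Fin.cons_succ,
    ne_eq, ite_not]

/-- Adjoining a free coordinate to a code doubles its size and adds `1 / 2` to its average
distance. -/
theorem avgDist_add_half_mem {n M : ℕ} (hM : 0 < M) {d : ℝ} (hd : d ∈ avgDistSet n M) :
    d + 1 / 2 ∈ avgDistSet (n + 1) (2 * M) := by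
  obtain ⟨A, hA, hcard, rfl⟩ := hd
  have hinj : Function.Injective
      (fun p : ℤ × (Fin n → ℤ) => (Fin.cons p.1 p.2 : Fin (n + 1) → ℤ)) := by
    rintro ⟨a, x⟩ ⟨b, y⟩ h
    obtain ⟨h₁, h₂⟩ := Fin.cons_injective2 h
    exact Prod.ext h₁ h₂
  have hB : ((({-1, 1} : Finset ℤ) ×ˢ A).image
      (fun p => (Fin.cons p.1 p.2 : Fin (n + 1) → ℤ))).card = 2 * M := by
    rw [Finset.card_image_of_injective _ hinj, Finset.card_product, hcard]
    rfl
  refine ⟨_, ?_, hB, ?_⟩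
  · simp only [Finset.mem_image, Finset.mem_product, Finset.mem_insert, Finset.mem_singleton]
    rintro _ ⟨⟨a, x⟩, ⟨ha, hx⟩, rfl⟩ i
    refine Fin.cases ?_ (fun j => ?_) i
    · simpa using ha
    · simpa using hA x hx j
  · have hM' : (M : ℝ) ≠ 0 := by positivity
    have h₁ : (-1 : ℤ) ≠ 1 := by decide
    simp only [avgDist, hB, hcard, Finset.sum_image hinj.injOn, Finset.sum_product,
      hammingDist_cons, Finset.sum_pair h₁, if_neg h₁, if_neg h₁.symm, if_true]
    push_cast
    simp only [Finset.sum_add_distrib, Finset.sum_const, hcard, nsmul_eq_mul]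
    field_simp
    ring

theorem avgDist_add_mem {n M : ℕ} (hM : 0 < M) {d : ℝ} (hd : d ∈ avgDistSet n M) (k : ℕ) :
    d + (k : ℝ) / 2 ∈ avgDistSet (n + k) (2 ^ k * M) := by
  induction k with
  | zero => simpa using hd
  | succ k ih =>
    have h := avgDist_add_half_mem (by positivity) ih
    rw [← mul_assoc, ← pow_succ'] at h
    have hd' : d + ((k + 1 : ℕ) : ℝ) / 2 = d + (k : ℝ) / 2 + 1 / 2 := by
      push_cast
      ring
    rw [hd']
    exact h

theorem avgDistSet_bddBelow (n M : ℕ) : BddBelow (avgDistSet n M) := by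
  refine ⟨0, ?_⟩
  rintro _ ⟨A, -, -, rfl⟩
  unfold avgDist
  positivity

theorem avgDistSet_nonempty {n M : ℕ} (h : M ≤ 2 ^ n) : (avgDistSet n M).Nonempty := by
  obtain ⟨A, hA, hcard⟩ := Finset.exists_subset_card_eq
    (s := Fintype.piFinset fun _ : Fin n => ({-1, 1} : Finset ℤ)) (n := M) (by simpa using h)
  refine ⟨_, A, fun x hx i => ?_, hcard, rfl⟩
  simpa using Fintype.mem_piFinset.1 (hA hx) i

theorem monotonicity (n M k : ℕ) (hn : 0 < n) (hM : 0 < M)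
    (hMle : M ≤ 2 ^ (n - 1)) :
    sInf (avgDistSet (n + k) (2 ^ k * M)) - (k : ℝ) / 2 ≤ sInf (avgDistSet n M) := by
  refine le_csInf (avgDistSet_nonempty
    (hMle.trans (Nat.pow_le_pow_right two_pos (Nat.sub_le n 1)))) fun d hd => ?_
  exact sub_le_iff_le_add.2 (csInf_le (avgDistSet_bddBelow _ _) (avgDist_add_mem hM hd k))
end

section
/- Let a be a real number with 1/4 < a ≤ 1/2 and let n be a positive integer with n ≥ (1−a)/(a − (1−2a)^2). Then Λ̄(n;a) ≤ 1/(2a) − 1. -/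
/-- Generalized binomial coefficient `C(y,j) = y(y-1)⋯(y-j+1)/j!`. -/
noncomputable def genChoose (y : ℝ) (j : ℕ) : ℝ :=
  (∏ i ∈ Finset.range j, (y - i)) / (Nat.factorial j)

/-- The Krawtchouk polynomial `K_k^{(n)}(x)`. -/
noncomputable def kraw (n k : ℕ) (x : ℝ) : ℝ :=
  ∑ j ∈ Finset.range (k + 1), (-1 : ℝ) ^ j * genChoose x j * genChoose ((n : ℝ) - x) (k - j)

/-- The value `Λ̄(n;a)` of Fu–Wei–Yeung's dual linear program. -/
noncomputable def LambdaBar (n : ℕ) (a : ℝ) : ℝ :=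
  sSup {v : ℝ | ∃ x : ℕ → ℝ,
    (∀ k ∈ Finset.Icc 1 n, 0 ≤ x k) ∧
    (∀ i ∈ Finset.Icc 2 n,
      -1 ≤ ∑ k ∈ Finset.Icc 1 n, (kraw n k 1 - kraw n k (i : ℝ)) * x k) ∧
    v = -∑ k ∈ Finset.Icc 1 n, (kraw n k 0 + kraw n k 1 * (1 / a - 1)) * x k}

theorem genChoose_natCast (m j : ℕ) : genChoose (m : ℝ) j = (m.choose j : ℝ) := by
  rw [genChoose, ← descPochhammer_eval_eq_prod_range, descPochhammer_eval_eq_descFactorial,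
    Nat.descFactorial_eq_factorial_mul_choose, Nat.cast_mul,
    mul_div_cancel_left₀ _ (Nat.cast_ne_zero.2 j.factorial_ne_zero)]

theorem kraw_natCast {n i : ℕ} (hi : i ≤ n) (k : ℕ) :
    kraw n k (i : ℝ) =
      ∑ j ∈ Finset.range (k + 1), (-1 : ℝ) ^ j * (i.choose j : ℝ) * ((n - i).choose (k - j) : ℝ) := by
  simp only [kraw, ← Nat.cast_sub hi, genChoose_natCast]

theorem kraw_zero (n k : ℕ) : kraw n k 0 = (n.choose k : ℝ) := by
  have h := kraw_natCast (Nat.zero_le n) k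
  rw [Nat.cast_zero] at h
  rw [h, Finset.sum_range_succ']
  simp

theorem kraw_one (n k : ℕ) :
    kraw (n + 1) (k + 1) 1 = (n.choose (k + 1) : ℝ) - (n.choose k : ℝ) := by
  have h := kraw_natCast (Nat.le_add_left 1 n) (k + 1)
  rw [Nat.cast_one] at h
  rw [h, Finset.sum_range_succ', Finset.sum_range_succ', Finset.sum_eq_zero]
  · simp
    ring
  · intro j _
    simp [Nat.choose_eq_zero_of_lt (show 1 < j + 1 + 1 by omega)]

theorem kraw_one_two (n : ℕ) : kraw (n + 2) 1 2 = (n : ℝ) - 2 := by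
  have h := kraw_natCast (Nat.le_add_left 2 n) 1
  rw [Nat.cast_ofNat] at h
  rw [h]
  simp [Finset.sum_range_succ]
  ring

theorem kraw_two (n k : ℕ) :
    kraw (n + 2) (k + 2) 2 =
      (n.choose (k + 2) : ℝ) - 2 * (n.choose (k + 1) : ℝ) + (n.choose k : ℝ) := by
  have h := kraw_natCast (Nat.le_add_left 2 n) (k + 2)
  rw [Nat.cast_ofNat] at h
  rw [h, Finset.sum_range_succ', Finset.sum_range_succ', Finset.sum_range_succ',
    Finset.sum_eq_zero]
  · simp
    ring
  · intro j _
    simp [Nat.choose_eq_zero_of_lt (show 2 < j + 1 + 1 + 1 by omega)]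

/-- The distribution with mass `a`, `1 / 2`, `1 / 2 - a` at distances `0`, `1`, `2` has a
nonnegative Krawtchouk transform. -/
theorem kraw_transform_nonneg {a : ℝ} (ha : 1 / 4 ≤ a) (n : ℕ) {k : ℕ} (hk : 1 ≤ k) :
    0 ≤ 2 * a * kraw (n + 2) k 0 + kraw (n + 2) k 1 + (1 - 2 * a) * kraw (n + 2) k 2 := by
  obtain ⟨k, rfl⟩ := Nat.exists_eq_add_of_le' hk
  rw [kraw_zero, kraw_one (n + 1)]
  rcases k with _ | k
  · rw [zero_add, kraw_one_two]
    simp only [Nat.choose_one_right, Nat.choose_zero_right]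
    push_cast
    have : (0 : ℝ) ≤ n := n.cast_nonneg
    linarith
  · rw [kraw_two]
    simp only [Nat.choose_succ_succ' (n + 1), Nat.choose_succ_succ' n]
    push_cast
    have hA : (0 : ℝ) ≤ (n.choose (k + 1 + 1) : ℝ) := Nat.cast_nonneg _
    have hB : (0 : ℝ) ≤ (n.choose (k + 1) : ℝ) := Nat.cast_nonneg _
    nlinarith [mul_nonneg (sub_nonneg.2 ha) hB]

theorem lambdaBar_upper_large_a (a : ℝ) (ha0 : 1 / 4 < a) (ha : a ≤ 1 / 2)
    (n : ℕ) (hn : 0 < n) (hna : (1 - a) / (a - (1 - 2 * a) ^ 2) ≤ n) :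
    LambdaBar n a ≤ 1 / (2 * a) - 1 := by
  have hapos : 0 < a := by linarith
  have hy : 0 ≤ 1 / (2 * a) - 1 := by
    rw [sub_nonneg, le_div_iff₀ (by linarith)]
    linarith
  refine Real.sSup_le ?_ hy
  rintro v ⟨x, hx, hc, rfl⟩
  obtain rfl | ⟨m, rfl⟩ : n = 1 ∨ ∃ m, n = m + 2 := by
    rcases n with _ | _ | m
    · omega
    · exact Or.inl rfl
    · exact Or.inr ⟨m, rfl⟩
  · have hden : 0 < a - (1 - 2 * a) ^ 2 := by nlinarith
    rw [div_le_iff₀ hden, Nat.cast_one] at hna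
    have ha' : a = 1 / 2 := by nlinarith
    subst ha'
    have h1 := kraw_zero 1 1
    have h2 := kraw_one 0 0
    norm_num at h1 h2
    norm_num [h1, h2]
  · have h2 := hc 2 (by simp)
    rw [Nat.cast_ofNat] at h2
    have key : (1 / (2 * a) - 1) * ∑ k ∈ Finset.Icc 1 (m + 2),
          (kraw (m + 2) k 1 - kraw (m + 2) k 2) * x k ≤
        ∑ k ∈ Finset.Icc 1 (m + 2),
          (kraw (m + 2) k 0 + kraw (m + 2) k 1 * (1 / a - 1)) * x k := by
      rw [Finset.mul_sum]
      refine Finset.sum_le_sum fun k hk => ?_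
      rw [← mul_assoc]
      refine mul_le_mul_of_nonneg_right ?_ (hx k hk)
      have h := div_nonneg (kraw_transform_nonneg ha0.le m (Finset.mem_Icc.1 hk).1)
        (by linarith : 0 ≤ 2 * a)
      rw [← sub_nonneg]
      convert h using 1
      field_simp
      ring
    linarith [mul_le_mul_of_nonneg_left h2 hy]
end

section
/- For every fixed real number a with 0 < a ≤ 1/2, the limit as n → ∞ of Λ̄(n;a) exists and equals θ(a). -/
/-- `θ(a) = (1−√a)²/a` for `0 < a < 1/4` and `θ(a) = 1/(2a) − 1` for `1/4 ≤ a ≤ 1/2`. -/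
noncomputable def theta (a : ℝ) : ℝ :=
  if a < 1 / 4 then (1 - Real.sqrt a) ^ 2 / a else 1 / (2 * a) - 1

theorem genChoose_zero_right (y : ℝ) : genChoose y 0 = 1 := by
  simp [genChoose]

theorem genChoose_succ (y : ℝ) (j : ℕ) :
    ((j : ℝ) + 1) * genChoose y (j + 1) = (y - j) * genChoose y j := by
  have h : (Nat.factorial j : ℝ) ≠ 0 := by positivity
  simp only [genChoose, Finset.prod_range_succ, Nat.factorial_succ]
  push_cast
  field_simp

theorem mul_genChoose_sub_one (y : ℝ) (j : ℕ) :
    y * genChoose (y - 1) j = (j + 1) * genChoose y (j + 1) := by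
  have h : (Nat.factorial j : ℝ) ≠ 0 := by positivity
  simp only [genChoose, Finset.prod_range_succ', Nat.factorial_succ]
  push_cast
  field_simp
  rw [sub_zero, mul_comm]
  congr 1
  exact Finset.prod_congr rfl fun i _ => by ring

theorem kraw_zero_left (n : ℕ) (x : ℝ) : kraw n 0 x = 1 := by
  simp [kraw, genChoose]

theorem kraw_at_zero (n k : ℕ) : kraw n k 0 = n.choose k := by
  rw [kraw, Finset.sum_eq_single 0]
  · simp [genChoose_zero_right, genChoose_natCast]
  · intro j _ hj
    have := genChoose_natCast 0 j
    rw [Nat.choose_eq_zero_of_lt (by omega)] at this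
    simp only [Nat.cast_zero] at this
    simp [this]
  · simp

theorem kraw_at_one (n k : ℕ) :
    n * kraw n k 1 = n.choose k * ((n : ℝ) - 2 * k) := by
  rcases k with _ | k
  · simp [kraw_zero_left]
  have hz : ∀ j : ℕ, genChoose 1 (j + 2) = 0 := fun j => by
    have := genChoose_natCast 1 (j + 2)
    rwa [Nat.choose_eq_zero_of_lt (by omega), Nat.cast_one, Nat.cast_zero] at this
  have h1 : genChoose 1 1 = 1 := by simp [genChoose]
  rw [kraw, Finset.sum_range_succ', Finset.sum_range_succ', ← genChoose_natCast]
  simp only [hz, add_assoc, Nat.reduceAdd, zero_add, h1, genChoose_zero_right, mul_zero, zero_mul,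
    Finset.sum_const_zero, Nat.add_sub_cancel, Nat.sub_zero, pow_zero, pow_one]
  have e1 := mul_genChoose_sub_one n k
  have e2 := mul_genChoose_sub_one n (k + 1)
  have e3 := genChoose_succ n (k + 1)
  push_cast at *
  linear_combination e2 + e3 - e1

theorem kraw_at_two (n k : ℕ) :
    n * ((n : ℝ) - 1) * kraw n k 2 = n.choose k * (((n : ℝ) - 2 * k) ^ 2 - n) := by
  rcases k with _ | _ | k
  · simp [kraw_zero_left]
    ring
  · simp [kraw, Finset.sum_range_succ, genChoose]
    ring
  have hz : ∀ j : ℕ, genChoose 2 (j + 3) = 0 := fun j => by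
    have := genChoose_natCast 2 (j + 3)
    rwa [Nat.choose_eq_zero_of_lt (by omega), Nat.cast_ofNat, Nat.cast_zero] at this
  have h1 : genChoose 2 1 = 2 := by simp [genChoose]
  have h2 : genChoose 2 2 = 1 := by norm_num [genChoose, Finset.prod_range_succ]
  rw [kraw, Finset.sum_range_succ', Finset.sum_range_succ', Finset.sum_range_succ',
    ← genChoose_natCast]
  simp only [hz, add_assoc, Nat.reduceAdd, zero_add, h1, h2, genChoose_zero_right, mul_zero,
    zero_mul, Finset.sum_const_zero, Nat.add_sub_cancel, Nat.sub_zero, pow_zero, pow_one]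
  have hk : k + 2 - 1 = k + 1 := rfl
  rw [hk]
  have descend : ∀ j : ℕ, (n : ℝ) * (n - 1) * genChoose ((n : ℝ) - 2) j =
      (j + 1) * ((j + 2) * genChoose n (j + 2)) := fun j => by
    have e1 := mul_genChoose_sub_one ((n : ℝ) - 1) j
    have e2 := mul_genChoose_sub_one (n : ℝ) (j + 1)
    rw [sub_sub, one_add_one_eq_two] at e1
    push_cast at *
    linear_combination n * e1 + (j + 1) * e2
  have d0 := descend k
  have d1 := descend (k + 1)
  have d2 := descend (k + 2)
  have e1 := genChoose_succ n (k + 2)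
  have e2 := genChoose_succ n (k + 3)
  push_cast at *
  simp only [add_assoc] at *
  norm_num at *
  linear_combination d0 - 2 * d1 + d2 + (k + 3) * e2 - (2 * (k + 2) - (n - k - 3)) * e1

/-- Generating function of the Krawtchouk polynomials, in homogeneous form. -/
theorem sum_kraw_mul_pow {n i : ℕ} (hi : i ≤ n) (p q : ℝ) :
    ∑ k ∈ Finset.range (n + 1), kraw n k i * (p ^ k * q ^ (n - k)) =
      (q - p) ^ i * (q + p) ^ (n - i) := by
  obtain ⟨m, rfl⟩ := Nat.exists_eq_add_of_le hi
  have hsub : ((i + m : ℕ) : ℝ) - i = m := by push_cast; ring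
  rw [Nat.add_sub_cancel_left, sub_eq_neg_add, add_comm q p, add_pow, add_pow, Finset.sum_mul_sum]
  simp only [kraw, hsub, genChoose_natCast, Finset.sum_mul]
  rw [← Finset.sum_product', Finset.sum_sigma']
  symm
  refine Finset.sum_of_injOn (fun x => ⟨x.1 + x.2, x.1⟩) ?_ ?_ ?_ ?_
  · rintro ⟨a, b⟩ _ ⟨c, d⟩ _ h
    simp only [Sigma.mk.injEq, heq_eq_eq] at h
    ext <;> simp <;> omega
  · rintro ⟨a, b⟩ h
    simp at h ⊢
    omega
  · rintro ⟨k, j⟩ hk hj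
    simp only [Finset.mem_sigma, Finset.mem_range] at hk
    by_cases h1 : i < j
    · simp [Nat.choose_eq_zero_of_lt h1]
    · by_cases h2 : m < k - j
      · simp [Nat.choose_eq_zero_of_lt h2]
      · refine absurd ⟨(j, k - j), ?_, ?_⟩ hj
        · simp
          omega
        · simp
          omega
  · rintro ⟨a, b⟩ h
    simp only [Finset.mem_product, Finset.mem_range] at h
    have hq : i + m - (a + b) = (i - a) + (m - b) := by omega
    simp only [Nat.add_sub_cancel_left, hq, pow_add, neg_pow p]
    ring

/-- The values attained by feasible points of the dual linear program. -/
def feasibleValues (n : ℕ) (a : ℝ) : Set ℝ :=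
  {v : ℝ | ∃ x : ℕ → ℝ,
    (∀ k ∈ Finset.Icc 1 n, 0 ≤ x k) ∧
    (∀ i ∈ Finset.Icc 2 n,
      -1 ≤ ∑ k ∈ Finset.Icc 1 n, (kraw n k 1 - kraw n k (i : ℝ)) * x k) ∧
    v = -∑ k ∈ Finset.Icc 1 n, (kraw n k 0 + kraw n k 1 * (1 / a - 1)) * x k}

theorem lambdaBar_eq_sSup (n : ℕ) (a : ℝ) : LambdaBar n a = sSup (feasibleValues n a) := rfl

theorem feasibleValues_nonempty (n : ℕ) (a : ℝ) : (feasibleValues n a).Nonempty :=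
  ⟨0, fun _ => 0, by simp⟩

/-- Weak duality against a multiplier `u` supported on the constraint `i = 2`. -/
theorem le_of_mem_feasibleValues {n : ℕ} {a u : ℝ} (hn : 2 ≤ n) (hu : 0 ≤ u)
    (h : ∀ k ∈ Finset.Icc 1 n, 0 ≤ (n : ℝ) * (n - 1) +
      (n - 1) * ((n : ℝ) - 2 * k) * (1 / a - 1 - u) + u * (((n : ℝ) - 2 * k) ^ 2 - n))
    {v : ℝ} (hv : v ∈ feasibleValues n a) : v ≤ u := by
  obtain ⟨x, hx, hc, rfl⟩ := hv
  have h2 := hc 2 (by simp [hn])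
  have hn' : (2 : ℝ) ≤ n := by exact_mod_cast hn
  have key : 0 ≤ ∑ k ∈ Finset.Icc 1 n, ((kraw n k 0 + kraw n k 1 * (1 / a - 1)) * x k -
      u * ((kraw n k 1 - kraw n k ((2 : ℕ) : ℝ)) * x k)) := by
    refine Finset.sum_nonneg fun k hk => ?_
    have hpos : 0 < (n : ℝ) * (n - 1) := by nlinarith
    have : 0 ≤ kraw n k 0 + kraw n k 1 * (1 / a - 1 - u) + u * kraw n k 2 := by
      refine nonneg_of_mul_nonneg_right (a := (n : ℝ) * (n - 1)) ?_ hpos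
      have e1 := kraw_at_one n k
      have e2 := kraw_at_two n k
      have := mul_nonneg (Nat.cast_nonneg (α := ℝ) (n.choose k)) (h k hk)
      rw [kraw_at_zero]
      refine this.trans_eq ?_
      linear_combination -(n - 1) * (1 / a - 1 - u) * e1 - u * e2
    have := mul_nonneg this (hx k hk)
    push_cast
    linarith
  rw [Finset.sum_sub_distrib, ← Finset.mul_sum] at key
  have h3 := mul_le_mul_of_nonneg_left h2 hu
  rw [mul_neg_one] at h3
  exact neg_le.1 (h3.trans (sub_nonneg.1 key))

/-- The binomial mixture of Krawtchouk polynomials with mean `-s` is dual feasible. -/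
theorem exists_mem_feasibleValues_ge {n : ℕ} {a s : ℝ} (hn : 1 ≤ n) (ha : 0 < a) (hs0 : 0 < s)
    (hs1 : s ≤ 1) : ∃ v ∈ feasibleValues n a, (s * (1 / a - 1) - 1) / (s + s ^ 2) ≤ v := by
  set q : ℝ := (1 - s) / 2 with hq
  set p : ℝ := (1 + s) / 2 with hp
  set m : ℝ := 1 / (s + s ^ 2) with hm
  have hm0 : 0 < m := by positivity
  have hmul : m * (s + s ^ 2) = 1 := by rw [hm]; field_simp
  have hq0 : 0 ≤ q := by rw [hq]; linarith
  have hp0 : 0 ≤ p := by rw [hp]; linarith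
  have hsum : ∀ i ≤ n, ∑ k ∈ Finset.Icc 1 n, kraw n k (i : ℝ) * (m * (p ^ k * q ^ (n - k))) =
      m * ((-s) ^ i - q ^ n) := fun i hi => by
    have e := sum_kraw_mul_pow hi p q
    rw [Finset.range_eq_Ico, Finset.sum_eq_sum_Ico_succ_bot (by omega), kraw_zero_left,
      show q - p = -s by rw [hq, hp]; ring, show q + p = 1 by rw [hq, hp]; ring] at e
    simp only [zero_add, pow_zero, one_mul, one_pow, mul_one, Nat.sub_zero] at e
    rw [← e, add_sub_cancel_left, Finset.mul_sum]
    exact Finset.sum_congr rfl fun k _ => by ring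
  have h0 := hsum 0 (by omega)
  have h1 := hsum 1 hn
  rw [Nat.cast_zero] at h0
  rw [Nat.cast_one] at h1
  refine ⟨_, ⟨fun k => m * (p ^ k * q ^ (n - k)), fun k _ => by positivity, ?_, rfl⟩, ?_⟩
  · intro i hi
    rw [Finset.mem_Icc] at hi
    simp only [sub_mul, Finset.sum_sub_distrib]
    rw [hsum i hi.2, h1]
    have : (-s) ^ i ≤ s ^ 2 := (le_abs_self _).trans (by
      rw [abs_pow, abs_neg, abs_of_pos hs0]
      exact pow_le_pow_of_le_one hs0.le hs1 hi.1)
    nlinarith [mul_le_mul_of_nonneg_left this hm0.le]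
  · simp only [add_mul, Finset.sum_add_distrib]
    have : ∑ k ∈ Finset.Icc 1 n, kraw n k 1 * (1 / a - 1) * (m * (p ^ k * q ^ (n - k))) =
        (1 / a - 1) * (m * ((-s) ^ 1 - q ^ n)) := by
      rw [← h1, Finset.mul_sum]
      exact Finset.sum_congr rfl fun k _ => by ring
    rw [this, h0, div_eq_mul_one_div, ← hm]
    have : 0 ≤ m * q ^ n * (1 / a) := by positivity
    simp only [pow_zero, pow_one]
    linarith

theorem exists_theta_eq {a : ℝ} (ha0 : 0 < a) :
    ∃ s : ℝ, 0 < s ∧ s ≤ 1 ∧ theta a = (s * (1 / a - 1) - 1) / (s + s ^ 2) := by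
  unfold theta
  split_ifs with h
  · obtain ⟨r, hr, rfl⟩ : ∃ r, 0 < r ∧ r ^ 2 = a := ⟨√a, by positivity, Real.sq_sqrt ha0.le⟩
    have hr2 : r < 1 / 2 := by nlinarith
    have hr1 : 0 < 1 - r := by linarith
    refine ⟨r / (1 - r), by positivity, by rw [div_le_one hr1]; linarith, ?_⟩
    rw [Real.sqrt_sq hr.le]
    field_simp
    ring
  · refine ⟨1, one_pos, le_rfl, ?_⟩
    field_simp
    ring

theorem theta_nonneg {a : ℝ} (ha0 : 0 < a) (ha : a ≤ 1 / 2) : 0 ≤ theta a := by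
  unfold theta
  split_ifs with h
  · positivity
  · rw [sub_nonneg, le_div_iff₀ (by positivity)]
    linarith

theorem mem_feasibleValues_le_theta {n : ℕ} {a : ℝ} (hn : 2 ≤ n) (ha : 1 / 4 ≤ a)
    (ha' : a ≤ 1 / 2) {v : ℝ} (hv : v ∈ feasibleValues n a) : v ≤ theta a := by
  have ha0 : 0 < a := by linarith
  have hu0 := theta_nonneg ha0 ha'
  refine le_of_mem_feasibleValues hn hu0 (fun k hk => ?_) hv
  have hb : 1 / a - 1 = 1 + 2 * theta a := by
    rw [theta, if_neg (by linarith)]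
    field_simp
    ring
  have hu1 : theta a ≤ 1 := by
    have : 1 / a ≤ 4 := by
      rw [div_le_iff₀ ha0]
      linarith
    linarith
  have factor : (n : ℝ) * (n - 1) + (n - 1) * ((n : ℝ) - 2 * k) * (1 / a - 1 - theta a) +
      theta a * (((n : ℝ) - 2 * k) ^ 2 - n) =
      2 * ((n : ℝ) - k) * (n - 1 + theta a * (n - 2 * k - 1)) := by
    rw [hb]
    ring
  rw [factor]
  rw [Finset.mem_Icc] at hk
  rcases hk.2.eq_or_lt with rfl | hlt
  · simp
  · have h1 : (k : ℝ) + 1 ≤ n := by exact_mod_cast hlt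
    have h2 : (2 : ℝ) ≤ n := by exact_mod_cast hn
    refine mul_nonneg (by linarith) ?_
    nlinarith

theorem eventually_mem_feasibleValues_le {a ε : ℝ} (ha0 : 0 < a) (ha : a < 1 / 4) (hε : 0 < ε)
    (hε1 : ε ≤ 1) :
    ∀ᶠ n : ℕ in Filter.atTop, ∀ v ∈ feasibleValues n a, v ≤ theta a + ε := by
  obtain ⟨w, hw, hθ, hb⟩ : ∃ w : ℝ, 0 < w ∧ theta a = w ^ 2 ∧ 1 / a - 1 = w ^ 2 + 2 * w := by
    obtain ⟨r, hr, rfl⟩ : ∃ r, 0 < r ∧ r ^ 2 = a := ⟨√a, by positivity, Real.sq_sqrt ha0.le⟩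
    have hr1 : 0 < 1 - r := by nlinarith
    refine ⟨(1 - r) / r, by positivity, ?_, ?_⟩
    · rw [theta, if_pos ha, Real.sqrt_sq hr.le, div_pow]
    · field_simp
      ring
  rw [hθ]
  set u := w ^ 2 + ε with hu
  have hu0 : 0 < u := by positivity
  set D := 4 * u - (1 / a - 1 - u) ^ 2 with hD
  have hD0 : 0 < D := by
    rw [hD, hb, hu]
    nlinarith [mul_pos hw hε]
  obtain ⟨M, hM⟩ := exists_nat_ge (8 * u ^ 2 / D)
  filter_upwards [Filter.eventually_ge_atTop (M + 2)] with n hn v hv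
  refine le_of_mem_feasibleValues (by omega) hu0.le (fun k _ => ?_) hv
  obtain ⟨N, hN⟩ : ∃ N : ℝ, N = n - 1 := ⟨_, rfl⟩
  have hn' : (M : ℝ) + 2 ≤ n := by exact_mod_cast hn
  have hM0 : (0 : ℝ) ≤ M := Nat.cast_nonneg M
  have hN1 : 1 ≤ N := by linarith
  have hND : 8 * u ^ 2 ≤ N * D := by
    rw [← div_le_iff₀ hD0]
    linarith
  have hdisc : 0 ≤ N ^ 2 * D + 4 * u * N * (1 - u) - 4 * u ^ 2 := by
    nlinarith [mul_le_mul_of_nonneg_left hND (by linarith : (0 : ℝ) ≤ N),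
      mul_nonneg (sq_nonneg u) (sub_nonneg.2 hN1), mul_pos hu0 (by linarith : 0 < N)]
  refine nonneg_of_mul_nonneg_right (a := 4 * u) ?_ (by positivity)
  have hsq := sq_nonneg (2 * u * ((n : ℝ) - 2 * k) + N * (1 / a - 1 - u))
  refine (add_nonneg hsq hdisc).trans_eq ?_
  rw [hD, show (n : ℝ) = N + 1 by linarith]
  ring

theorem lambdaBar_tendsto_theta (a : ℝ) (ha0 : 0 < a) (ha : a ≤ 1 / 2) :
    Filter.Tendsto (fun n : ℕ => LambdaBar n a) Filter.atTop (nhds (theta a)) := by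
  have lower : ∀ n : ℕ, 1 ≤ n → BddAbove (feasibleValues n a) → theta a ≤ LambdaBar n a := by
    intro n hn hbdd
    obtain ⟨s, hs0, hs1, hs⟩ := exists_theta_eq ha0
    obtain ⟨v, hv, hle⟩ := exists_mem_feasibleValues_ge hn ha0 hs0 hs1
    rw [hs, lambdaBar_eq_sSup]
    exact hle.trans (le_csSup hbdd hv)
  have upper : ∀ ε : ℝ, 0 < ε → ε ≤ 1 →
      ∀ᶠ n : ℕ in Filter.atTop, ∀ v ∈ feasibleValues n a, v ≤ theta a + ε := by
    intro ε hε hε1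
    rcases lt_or_ge a (1 / 4) with h | h
    · exact eventually_mem_feasibleValues_le ha0 h hε hε1
    · filter_upwards [Filter.eventually_ge_atTop 2] with n hn v hv
      linarith [mem_feasibleValues_le_theta hn h ha hv]
  rw [Metric.tendsto_nhds]
  intro ε hε
  filter_upwards [upper (min (ε / 2) 1) (by positivity) (min_le_right _ _),
    Filter.eventually_ge_atTop 1] with n hup hn
  have h1 := lower n hn ⟨_, hup⟩
  have h2 : LambdaBar n a ≤ _ := csSup_le (feasibleValues_nonempty n a) hup
  have h3 := min_le_left (ε / 2) 1
  rw [Real.dist_eq, abs_of_nonneg (by linarith)]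
  linarith
end

section
/- Let f: {-1,1}^n → {-1,1} be a Boolean function and set a := |f^{-1}(1)|/2^n. If 0 < a ≤ 1/2, then the degree-1 Fourier weight satisfies W_1 ≤ 8a^2·φ(a). -/
/-- The Boolean cube `{-1,1}^n` as a finset of functions `Fin n → ℤ`. -/
def cube (n : ℕ) : Finset (Fin n → ℤ) :=
  Fintype.piFinset fun _ => ({-1, 1} : Finset ℤ)

/-- The Fourier coefficient `f̂_S` of `f : {-1,1}^n → {-1,1}`. -/
noncomputable def fCoeff (n : ℕ) (f : (Fin n → ℤ) → ℤ) (S : Finset (Fin n)) : ℝ :=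
  ((2 : ℝ) ^ n)⁻¹ * ∑ x ∈ cube n, (f x : ℝ) * ∏ i ∈ S, (x i : ℝ)

/-- The degree-`m` Fourier weight `W_m` of `f`. -/
noncomputable def fourierWeight (n : ℕ) (f : (Fin n → ℤ) → ℤ) (m : ℕ) : ℝ :=
  ∑ S ∈ Finset.univ.filter (fun S : Finset (Fin n) => S.card = m), (fCoeff n f S) ^ 2

/-- The density `a = |f⁻¹(1)|/2^n` of the Boolean function `f`. -/
noncomputable def density (n : ℕ) (f : (Fin n → ℤ) → ℤ) : ℝ :=
  (((cube n).filter fun x => f x = 1).card : ℝ) / 2 ^ n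

/-- The unnormalised Fourier coefficient at `S` of the indicator of `A`. -/
noncomputable def charSum {n : ℕ} (A : Finset (Fin n → ℤ)) (S : Finset (Fin n)) : ℝ :=
  ∑ x ∈ A, ∏ i ∈ S, (x i : ℝ)

theorem mem_cube {n : ℕ} {x : Fin n → ℤ} : x ∈ cube n ↔ ∀ i, x i = -1 ∨ x i = 1 := by
  simp [cube, Fintype.mem_piFinset]

/-- The noise stability of a set, expanded in characters. -/
theorem sum_pow_card_mul_charSum_sq {n : ℕ} (A : Finset (Fin n → ℤ)) (r : ℝ) :
    ∑ S : Finset (Fin n), r ^ S.card * charSum A S ^ 2 =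
      ∑ x ∈ A, ∑ y ∈ A, ∏ i, (1 + r * (x i * y i)) := by
  have h : ∀ x y : Fin n → ℤ, ∏ i, (1 + r * ((x i : ℝ) * y i)) =
      ∑ S : Finset (Fin n), r ^ S.card * ((∏ i ∈ S, (x i : ℝ)) * ∏ i ∈ S, (y i : ℝ)) := by
    intro x y
    rw [Finset.prod_one_add]
    simp [Finset.prod_mul_distrib]
  simp_rw [h]
  rw [Finset.sum_congr rfl fun x _ => Finset.sum_comm, Finset.sum_comm]
  refine Finset.sum_congr rfl fun S _ => ?_
  rw [charSum, sq, Finset.sum_mul_sum, Finset.mul_sum]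
  simp_rw [Finset.mul_sum]

/-- The noise stability of a subset of the cube is nonnegative. -/
theorem sum_pow_card_mul_charSum_sq_nonneg {n : ℕ} {A : Finset (Fin n → ℤ)} (hA : A ⊆ cube n)
    {r : ℝ} (hr : |r| ≤ 1) : 0 ≤ ∑ S : Finset (Fin n), r ^ S.card * charSum A S ^ 2 := by
  rw [sum_pow_card_mul_charSum_sq]
  refine Finset.sum_nonneg fun x hx => Finset.sum_nonneg fun y hy => Finset.prod_nonneg fun i _ => ?_
  obtain ⟨h1, h2⟩ := abs_le.1 hr
  rcases mem_cube.1 (hA hx) i with h | h <;> rcases mem_cube.1 (hA hy) i with h' | h' <;>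
    rw [h, h'] <;> push_cast <;> linarith

/-- Parseval's identity for the indicator of a subset of the cube. -/
theorem sum_charSum_sq {n : ℕ} {A : Finset (Fin n → ℤ)} (hA : A ⊆ cube n) :
    ∑ S : Finset (Fin n), charSum A S ^ 2 = 2 ^ n * A.card := by
  have h := sum_pow_card_mul_charSum_sq A 1
  simp only [one_pow, one_mul] at h
  rw [h]
  have h2 : ∀ x ∈ A, ∑ y ∈ A, ∏ i, (1 + (x i : ℝ) * y i) = 2 ^ n := by
    intro x hx
    rw [Finset.sum_eq_single_of_mem x hx]
    · have : ∀ i, (1 + (x i : ℝ) * x i) = 2 := by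
        intro i
        rcases mem_cube.1 (hA hx) i with h | h <;> rw [h] <;> norm_num
      simp [this]
    · intro y hy hne
      obtain ⟨i, hi⟩ := Function.ne_iff.1 hne
      refine Finset.prod_eq_zero (Finset.mem_univ i) ?_
      rcases mem_cube.1 (hA hx) i with h | h <;> rcases mem_cube.1 (hA hy) i with h' | h' <;>
        simp_all
  rw [Finset.sum_congr rfl h2]
  simp [mul_comm]

theorem sum_cube_apply (n : ℕ) (i : Fin n) : ∑ x ∈ cube n, (x i : ℝ) = 0 := by
  have h : ∑ x ∈ cube n, (x i : ℝ) = ∑ x ∈ cube n, -(x i : ℝ) := by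
    refine Finset.sum_bij' (fun x _ => -x) (fun x _ => -x) ?_ ?_ ?_ ?_ ?_ <;>
      simp only [mem_cube, Pi.neg_apply, neg_neg, implies_true, Int.cast_neg]
    all_goals
      intro x hx j
      rcases hx j with h | h <;> simp [h]
  rw [Finset.sum_neg_distrib] at h
  linarith

theorem fCoeff_eq_charSum {n : ℕ} {f : (Fin n → ℤ) → ℤ} (hf : ∀ x ∈ cube n, f x = -1 ∨ f x = 1)
    {S : Finset (Fin n)} (hS : S.card = 1) :
    fCoeff n f S = 2 * charSum ((cube n).filter fun x => f x = 1) S / 2 ^ n := by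
  obtain ⟨i, rfl⟩ := Finset.card_eq_one.1 hS
  have h : ∑ x ∈ cube n, (f x : ℝ) * (x i : ℝ) =
      ∑ x ∈ cube n, (2 * (if f x = 1 then (x i : ℝ) else 0) - x i) := by
    refine Finset.sum_congr rfl fun x hx => ?_
    rcases hf x hx with h | h <;> simp [h]
    ring
  simp only [fCoeff, charSum, Finset.prod_singleton, h, Finset.sum_sub_distrib, sum_cube_apply,
    ← Finset.mul_sum, Finset.sum_filter]
  ring

/-- Nonnegativity of the noise stability with correlation `-s`, after bounding all levels above
the first by Parseval's identity. -/
theorem sum_charSum_sq_card_one_le {n : ℕ} {A : Finset (Fin n → ℤ)} (hA : A ⊆ cube n) {s : ℝ}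
    (hs0 : 0 ≤ s) (hs1 : s ≤ 1) :
    (s + s ^ 2) * ∑ S ∈ Finset.univ.filter (fun S : Finset (Fin n) => S.card = 1),
      charSum A S ^ 2 ≤ (1 - s ^ 2) * (A.card : ℝ) ^ 2 + s ^ 2 * (2 ^ n * A.card) := by
  have h0 := sum_pow_card_mul_charSum_sq_nonneg hA (r := -s) (by rwa [abs_neg, abs_of_nonneg hs0])
  have hle : ∀ S : Finset (Fin n), (-s) ^ S.card * charSum A S ^ 2 ≤
      s ^ 2 * charSum A S ^ 2 + (if S = ∅ then (1 - s ^ 2) * charSum A S ^ 2 else 0) -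
        (s + s ^ 2) * (if S.card = 1 then charSum A S ^ 2 else 0) := by
    intro S
    rcases Nat.lt_or_ge S.card 2 with h | h
    · interval_cases hc : S.card
      · rw [Finset.card_eq_zero] at hc
        simp only [hc, if_true]
        norm_num
        linarith
      · have : S ≠ ∅ := by rintro rfl; simp at hc
        simp only [this, if_true, if_false]
        linarith
    · have h1 : S ≠ ∅ := by rintro rfl; simp at h
      have h2 : S.card ≠ 1 := by omega
      simp only [h1, h2, if_false, add_zero, mul_zero, sub_zero]
      refine mul_le_mul_of_nonneg_right ?_ (sq_nonneg _)
      calc (-s) ^ S.card ≤ |(-s) ^ S.card| := le_abs_self _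
        _ = s ^ S.card := by rw [abs_pow, abs_neg, abs_of_nonneg hs0]
        _ ≤ s ^ 2 := pow_le_pow_of_le_one hs0 hs1 h
  have h1 := h0.trans (Finset.sum_le_sum fun S _ => hle S)
  rw [Finset.sum_sub_distrib, Finset.sum_add_distrib, ← Finset.mul_sum, ← Finset.mul_sum,
    sum_charSum_sq hA, Finset.sum_ite_eq' Finset.univ, ← Finset.sum_filter] at h1
  have h2 : charSum A ∅ = A.card := by simp [charSum]
  simp only [Finset.mem_univ, if_true, h2] at h1
  linarith

theorem fourierWeight_one_le {n : ℕ} {f : (Fin n → ℤ) → ℤ}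
    (hf : ∀ x ∈ cube n, f x = -1 ∨ f x = 1) {t : ℝ} (ht0 : 0 < t) (ht : t ≤ 1 / 2) :
    fourierWeight n f 1 ≤ 4 * (t * density n f + (1 / t - 2) * density n f ^ 2) := by
  have hM : (0 : ℝ) < 2 ^ n := by positivity
  have ht1 : 0 < 1 - t := by linarith
  have key := sum_charSum_sq_card_one_le (A := (cube n).filter fun x => f x = 1)
    (Finset.filter_subset _ _) (s := t / (1 - t)) (by positivity)
    (by rw [div_le_one ht1]; linarith)
  have hW : fourierWeight n f 1 = 4 / (2 ^ n) ^ 2 *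
      ∑ S ∈ Finset.univ.filter (fun S : Finset (Fin n) => S.card = 1),
        charSum ((cube n).filter fun x => f x = 1) S ^ 2 := by
    rw [fourierWeight, Finset.mul_sum]
    refine Finset.sum_congr rfl fun S hS => ?_
    rw [fCoeff_eq_charSum hf (Finset.mem_filter.1 hS).2]
    ring
  rw [hW, density]
  generalize (∑ S ∈ Finset.univ.filter (fun S : Finset (Fin n) => S.card = 1),
        charSum ((cube n).filter fun x => f x = 1) S ^ 2) = T at *
  generalize (((cube n).filter fun x => f x = 1).card : ℝ) = N at *
  generalize (2 : ℝ) ^ n = M at *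
  have e1 : t / (1 - t) + (t / (1 - t)) ^ 2 = t / (1 - t) ^ 2 := by field_simp; ring
  have e2 : (1 - (t / (1 - t)) ^ 2) * N ^ 2 + (t / (1 - t)) ^ 2 * (M * N) =
      t / (1 - t) ^ 2 * (t * (M * N) + (1 / t - 2) * N ^ 2) := by field_simp; ring
  rw [e1, e2] at key
  have hT := le_of_mul_le_mul_left key (by positivity)
  calc 4 / M ^ 2 * T ≤ 4 / M ^ 2 * (t * (M * N) + (1 / t - 2) * N ^ 2) := by gcongr
    _ = _ := by field_simp

theorem weight_one_le (n : ℕ) (f : (Fin n → ℤ) → ℤ)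
    (hf : ∀ x ∈ cube n, f x = -1 ∨ f x = 1)
    (ha0 : 0 < density n f) (ha : density n f ≤ 1 / 2) :
    fourierWeight n f 1 ≤ 8 * (density n f) ^ 2 * phi (density n f) := by
  rw [phi]
  split_ifs with h
  · have hs : 0 < √(density n f) := Real.sqrt_pos.2 ha0
    have hsq : √(density n f) ^ 2 = density n f := Real.sq_sqrt ha0.le
    have hs2 : √(density n f) ≤ 1 / 2 := by
      rw [Real.sqrt_le_left (by norm_num)]
      linarith
    refine (fourierWeight_one_le hf hs hs2).trans_eq ?_
    generalize √(density n f) = t at *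
    rw [← hsq]
    field_simp
    ring
  · refine (fourierWeight_one_le hf (t := 1 / 2) (by norm_num) le_rfl).trans_eq ?_
    field_simp
    ring
end

section
/- Let n and k be integers with 2 ≤ k ≤ n, and let x₁ denote the smallest real root of the polynomial function y ↦ K_{k−1}^{(n−1)}(y) (which has k−1 distinct real roots). Then for every real number x with 0 ≤ x ≤ x₁, one has K_k^{(n)}(x) ≥ K_k^{(n)}(x+1). -/
theorem genChoose_zero_succ (j : ℕ) : genChoose 0 (j + 1) = 0 := by
  simp [genChoose, Finset.prod_range_succ']

/-- Pascal's rule for the generalized binomial coefficient. -/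
theorem genChoose_succ_succ (y : ℝ) (j : ℕ) :
    genChoose (y + 1) (j + 1) = genChoose y (j + 1) + genChoose y j := by
  have hshift : ∏ i ∈ Finset.range j, (y + 1 - ((i + 1 : ℕ) : ℝ)) =
      ∏ i ∈ Finset.range j, (y - i) :=
    Finset.prod_congr rfl fun i _ => by push_cast; ring
  have hfac : (j.factorial : ℝ) ≠ 0 := by positivity
  have hsucc : (j : ℝ) + 1 ≠ 0 := by positivity
  unfold genChoose
  rw [Finset.prod_range_succ', hshift, Finset.prod_range_succ, Nat.factorial_succ]
  push_cast
  field_simp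
  ring

theorem genChoose_nonneg_of_natCast_le {y : ℝ} {j : ℕ} (h : (j : ℝ) ≤ y) :
    0 ≤ genChoose y j := by
  refine div_nonneg (Finset.prod_nonneg fun i hi => ?_) (by positivity)
  have : (i : ℝ) < j := by exact_mod_cast Finset.mem_range.mp hi
  linarith

@[fun_prop]
theorem continuous_genChoose (j : ℕ) : Continuous fun y => genChoose y j := by
  unfold genChoose
  fun_prop

theorem continuous_kraw (n k : ℕ) : Continuous (kraw n k) := by
  have hsub (j : ℕ) : Continuous fun x : ℝ => genChoose ((n : ℝ) - x) j :=
    (continuous_genChoose j).comp (by fun_prop)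
  unfold kraw
  fun_prop

theorem kraw_zero_right (n k : ℕ) : kraw n k 0 = genChoose n k := by
  simp [kraw, Finset.sum_range_succ', genChoose_zero_succ, genChoose_zero_right]

theorem kraw_succ_succ (n k : ℕ) (x : ℝ) :
    kraw (n + 1) (k + 1) x = kraw n (k + 1) x + kraw n k x := by
  have hn : ((n + 1 : ℕ) : ℝ) - x = (n - x) + 1 := by push_cast; ring
  unfold kraw
  rw [hn, Finset.sum_range_succ, Finset.sum_range_succ _ (k + 1), add_right_comm,
    ← Finset.sum_add_distrib]
  simp only [Nat.sub_self, genChoose_zero_right]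
  congr 1
  refine Finset.sum_congr rfl fun j hj => ?_
  rw [Nat.succ_sub (Nat.lt_succ_iff.mp (Finset.mem_range.mp hj)), genChoose_succ_succ]
  ring

theorem kraw_succ_succ_add_one (n k : ℕ) (x : ℝ) :
    kraw (n + 1) (k + 1) (x + 1) = kraw n (k + 1) x - kraw n k x := by
  have hn : ((n + 1 : ℕ) : ℝ) - (x + 1) = n - x := by push_cast; ring
  unfold kraw
  rw [hn, Finset.sum_range_succ', Finset.sum_range_succ' _ (k + 1), add_sub_right_comm,
    ← Finset.sum_sub_distrib]
  simp only [genChoose_zero_right]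
  congr 1
  refine Finset.sum_congr rfl fun j _ => ?_
  rw [Nat.add_sub_add_right, genChoose_succ_succ]
  ring

/-- A Krawtchouk polynomial is nonnegative between `0` and any lower bound of its roots. -/
theorem kraw_nonneg_of_le_roots {n k : ℕ} (hkn : k ≤ n) {x : ℝ} (hx0 : 0 ≤ x)
    (hx : ∀ y : ℝ, kraw n k y = 0 → x ≤ y) : 0 ≤ kraw n k x := by
  by_contra! hneg
  have h0 : 0 ≤ kraw n k 0 := by
    rw [kraw_zero_right]
    exact genChoose_nonneg_of_natCast_le (by exact_mod_cast hkn)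
  obtain ⟨y, hy, hy0⟩ :=
    intermediate_value_Icc' hx0 (continuous_kraw n k).continuousOn ⟨hneg.le, h0⟩
  rw [le_antisymm (hx y hy0) hy.2, hy0] at hneg
  exact lt_irrefl _ hneg

theorem kraw_monotone_below_first_root (n k : ℕ) (hk : 2 ≤ k) (hkn : k ≤ n)
    (x₁ : ℝ) (hroot : kraw (n - 1) (k - 1) x₁ = 0)
    (hmin : ∀ y : ℝ, kraw (n - 1) (k - 1) y = 0 → x₁ ≤ y)
    (x : ℝ) (hx0 : 0 ≤ x) (hx1 : x ≤ x₁) :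
    kraw n k (x + 1) ≤ kraw n k x := by
  obtain ⟨k, rfl⟩ : ∃ m, k = m + 1 := ⟨k - 1, by omega⟩
  obtain ⟨n, rfl⟩ : ∃ m, n = m + 1 := ⟨n - 1, by omega⟩
  have hnonneg : 0 ≤ kraw n k x :=
    kraw_nonneg_of_le_roots (by omega) hx0 fun y hy => hx1.trans (hmin y hy)
  rw [kraw_succ_succ_add_one, kraw_succ_succ]
  linarith
end

section
/- Let n ≥ 1 be an integer and let k and x be integers with 0 ≤ k ≤ n and 0 ≤ x ≤ n. Then |K_k^{(n)}(x)| < 2^{(n/2)(1 + H(k/n) − H(x/n) + (1/n)·log₂(n+1))}. -/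
/-- The binary entropy function `H(p) = −p·log₂ p − (1−p)·log₂(1−p)`. -/
noncomputable def binEnt (p : ℝ) : ℝ :=
  -p * Real.logb 2 p - (1 - p) * Real.logb 2 (1 - p)

open Polynomial in
/-- The generating polynomial `(1 - X)^x (1 + X)^(n - x)` of the Krawtchouk values at `x`. -/
noncomputable def krawGen (n x : ℕ) : ℝ[X] := (1 - X) ^ x * (1 + X) ^ (n - x)

open Polynomial in
theorem coeff_one_sub_X_pow (m j : ℕ) :
    ((1 - X : ℝ[X]) ^ m).coeff j = (-1) ^ j * (m.choose j : ℝ) := by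
  have h : (1 - X : ℝ[X]) ^ m = ((1 + X) ^ m : ℝ[X]).comp (C (-1) * X) := by
    simp [sub_eq_add_neg]
  rw [h, comp_C_mul_X_coeff, coeff_one_add_X_pow, mul_comm]

theorem coeff_krawGen {n x : ℕ} (hx : x ≤ n) (k : ℕ) :
    (krawGen n x).coeff k = kraw n k (x : ℝ) := by
  rw [krawGen, Polynomial.coeff_mul, Finset.Nat.sum_antidiagonal_eq_sum_range_succ_mk, kraw]
  refine Finset.sum_congr rfl fun j _ => ?_
  rw [← Nat.cast_sub hx, genChoose_natCast, genChoose_natCast, coeff_one_sub_X_pow,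
    Polynomial.coeff_one_add_X_pow]

open Polynomial in
theorem sum_choose_mul_krawGen (n : ℕ) :
    ∑ x ∈ Finset.range (n + 1),
        (C (krawGen n x) * (krawGen n x).map C) * ((n.choose x : ℕ) : ℝ[X][X]) =
      ∑ m ∈ Finset.range (n + 1), C (C ((2 : ℝ) ^ n * (n.choose m : ℝ)) * X ^ m) * X ^ m := by
  trans (2 * (C X * X + 1) : ℝ[X][X]) ^ n
  · have h : (2 * (C X * X + 1) : ℝ[X][X]) =
        (1 - C X) * (1 - X) + (1 + C X) * (1 + X) := by ring
    rw [h, add_pow]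
    refine Finset.sum_congr rfl fun x _ => ?_
    simp only [krawGen, Polynomial.map_mul, Polynomial.map_pow, Polynomial.map_sub,
      Polynomial.map_add, Polynomial.map_one, Polynomial.map_X, map_mul, map_pow, map_sub,
      map_add, map_one, mul_pow]
    ring
  · rw [mul_pow, add_pow, Finset.mul_sum]
    refine Finset.sum_congr rfl fun m _ => ?_
    simp only [one_pow, map_mul, map_pow, map_natCast, map_ofNat, mul_pow]
    ring

/-- The Krawtchouk polynomial `K_k` has squared norm `2^n C(n,k)` for the binomial weight. -/
theorem sum_choose_mul_kraw_sq {n k : ℕ} (hk : k ≤ n) :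
    ∑ x ∈ Finset.range (n + 1), (n.choose x : ℝ) * kraw n k (x : ℝ) ^ 2 =
      2 ^ n * (n.choose k : ℝ) := by
  have h := congrArg (fun p => (p.coeff k).coeff k) (sum_choose_mul_krawGen n)
  simp only [Polynomial.finsetSum_coeff, Polynomial.coeff_mul_natCast,
    Polynomial.coeff_C_mul, Polynomial.coeff_map, Polynomial.coeff_mul_C,
    Polynomial.coeff_X_pow, mul_ite, mul_one, mul_zero,
    apply_ite (fun p : Polynomial ℝ => p.coeff k), Polynomial.coeff_zero] at h
  rw [Finset.sum_ite_eq, if_pos (Finset.mem_range.2 (by omega))] at h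
  simp only [if_true] at h
  rw [← h]
  refine Finset.sum_congr rfl fun x hx => ?_
  rw [coeff_krawGen (by simpa [Nat.lt_succ_iff] using hx)]
  ring

theorem choose_mul_kraw_sq_le {n k x : ℕ} (hk : k ≤ n) (hx : x ≤ n) :
    (n.choose x : ℝ) * kraw n k (x : ℝ) ^ 2 ≤ 2 ^ n * (n.choose k : ℝ) := by
  rw [← sum_choose_mul_kraw_sq hk]
  exact Finset.single_le_sum (f := fun x : ℕ => (n.choose x : ℝ) * kraw n k (x : ℝ) ^ 2)
    (fun i _ => by positivity) (Finset.mem_range.2 (by omega))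

theorem factorial_mul_pow_le (a b : ℕ) :
    a.factorial * a ^ b ≤ b.factorial * a ^ a := by
  rcases le_total a b with h | h
  · calc a.factorial * a ^ b = a.factorial * a ^ (b - a) * a ^ a := by
          rw [mul_assoc, ← pow_add, Nat.sub_add_cancel h]
      _ ≤ b.factorial * a ^ a := by
          gcongr
          exact Nat.factorial_mul_pow_sub_le_factorial h
  · calc a.factorial * a ^ b ≤ b.factorial * a ^ (a - b) * a ^ b := by
          gcongr
          rw [← Nat.factorial_mul_descFactorial (Nat.sub_le a b), Nat.sub_sub_self h]
          gcongr
          exact Nat.descFactorial_le_pow a (a - b)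
      _ = b.factorial * a ^ a := by rw [mul_assoc, ← pow_add, Nat.sub_add_cancel h]

/-- The binomial distribution with success probability `x / n` has `x` as a mode. -/
theorem choose_mul_pow_le_mode {n x j : ℕ} (hx : x ≤ n) (hj : j ≤ n) :
    n.choose j * (x ^ j * (n - x) ^ (n - j)) ≤ n.choose x * (x ^ x * (n - x) ^ (n - x)) := by
  have h := Nat.mul_le_mul (factorial_mul_pow_le x j) (factorial_mul_pow_le (n - x) (n - j))
  have hcx := Nat.choose_mul_factorial_mul_factorial hx
  have hcj := Nat.choose_mul_factorial_mul_factorial hj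
  refine le_of_mul_le_mul_left (a := n.factorial) ?_
    n.factorial_pos
  calc _ = n.choose x * n.choose j *
        (x.factorial * x ^ j * ((n - x).factorial * (n - x) ^ (n - j))) := by
        rw [← hcx]; ring
    _ ≤ n.choose x * n.choose j *
        (j.factorial * x ^ x * ((n - j).factorial * (n - x) ^ (n - x))) := by gcongr
    _ = _ := by rw [← hcj]; ring

theorem sum_choose_mul_pow {n x : ℕ} (hx : x ≤ n) :
    ∑ j ∈ Finset.range (n + 1), n.choose j * (x ^ j * (n - x) ^ (n - j)) = n ^ n := by
  have h := add_pow x (n - x) n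
  rw [Nat.add_sub_cancel' hx] at h
  rw [h]
  exact Finset.sum_congr rfl fun j _ => by rw [Nat.cast_id, mul_comm]

theorem choose_mul_pow_self_le {n k : ℕ} (hk : k ≤ n) :
    n.choose k * (k ^ k * (n - k) ^ (n - k)) ≤ n ^ n := by
  rw [← sum_choose_mul_pow hk]
  exact Finset.single_le_sum (f := fun j => n.choose j * (k ^ j * (n - k) ^ (n - j)))
    (fun _ _ => Nat.zero_le _) (Finset.mem_range.2 (by omega))

theorem pow_self_lt_succ_mul_choose {n x : ℕ} (hn : 1 ≤ n) (hx : x ≤ n) :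
    n ^ n < (n + 1) * (n.choose x * (x ^ x * (n - x) ^ (n - x))) := by
  rw [← sum_choose_mul_pow hx]
  have hle : ∀ j ∈ Finset.range (n + 1), n.choose j * (x ^ j * (n - x) ^ (n - j)) ≤
      n.choose x * (x ^ x * (n - x) ^ (n - x)) := fun j hj =>
    choose_mul_pow_le_mode hx (by simpa [Nat.lt_succ_iff] using hj)
  have hlt : ∃ j ∈ Finset.range (n + 1), n.choose j * (x ^ j * (n - x) ^ (n - j)) <
      n.choose x * (x ^ x * (n - x) ^ (n - x)) := by
    rcases x with _ | y
    · exact ⟨1, Finset.mem_range.2 (by omega), by simp [Nat.pow_self_pos]⟩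
    · refine ⟨y, Finset.mem_range.2 (by omega), ?_⟩
      have hc := Nat.choose_succ_right_eq n y
      have hpos : 0 < n.choose y * ((y + 1) ^ y * (n - (y + 1)) ^ (n - (y + 1))) := by
        have : 0 < n.choose y := Nat.choose_pos (by omega)
        have : 0 < (n - (y + 1)) ^ (n - (y + 1)) := Nat.pow_self_pos
        positivity
      have hs : n - y = n - (y + 1) + 1 := by omega
      calc n.choose y * ((y + 1) ^ y * (n - (y + 1)) ^ (n - y))
          = n.choose y * ((y + 1) ^ y * (n - (y + 1)) ^ (n - (y + 1))) * (n - (y + 1)) := by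
            rw [hs, pow_succ]; ring
        _ < n.choose y * ((y + 1) ^ y * (n - (y + 1)) ^ (n - (y + 1))) * (n - y) :=
            Nat.mul_lt_mul_of_pos_left (by omega) hpos
        _ = n.choose y * (n - y) * ((y + 1) ^ y * (n - (y + 1)) ^ (n - (y + 1))) := by ring
        _ = _ := by rw [← hc, pow_succ (y + 1) y]; ring
  simpa using Finset.sum_lt_sum hle hlt

theorem two_rpow_natCast_mul_logb {p : ℝ} {a : ℕ} (hp : a ≠ 0 → 0 < p) :
    (2 : ℝ) ^ ((a : ℝ) * Real.logb 2 p) = p ^ a := by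
  rcases eq_or_ne a 0 with rfl | ha
  · simp
  · rw [mul_comm, Real.rpow_mul (by norm_num),
      Real.rpow_logb (by norm_num) (by norm_num) (hp ha), Real.rpow_natCast]

theorem two_rpow_mul_binEnt {n a : ℕ} (hn : 1 ≤ n) (ha : a ≤ n) :
    (2 : ℝ) ^ ((n : ℝ) * binEnt ((a : ℝ) / n)) =
      (n : ℝ) ^ n / ((a ^ a * (n - a) ^ (n - a) : ℕ) : ℝ) := by
  have hn0 : (0 : ℝ) < n := by exact_mod_cast hn
  have hsub : 1 - (a : ℝ) / n = ((n - a : ℕ) : ℝ) / n := by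
    rw [Nat.cast_sub ha]; field_simp
  have hexp : (n : ℝ) * binEnt ((a : ℝ) / n) =
      -((a : ℝ) * Real.logb 2 ((a : ℝ) / n) +
        ((n - a : ℕ) : ℝ) * Real.logb 2 (((n - a : ℕ) : ℝ) / n)) := by
    rw [binEnt, hsub]; field_simp; ring
  rw [hexp, Real.rpow_neg (by norm_num), Real.rpow_add (by norm_num),
    two_rpow_natCast_mul_logb fun h => by positivity,
    two_rpow_natCast_mul_logb fun h => by positivity, div_pow, div_pow,
    div_mul_div_comm, ← pow_add, Nat.add_sub_cancel' ha, inv_div]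
  push_cast
  rfl

theorem kraw_abs_lt (n k x : ℕ) (hn : 1 ≤ n) (hk : k ≤ n) (hx : x ≤ n) :
    |kraw n k (x : ℝ)| <
      2 ^ (((n : ℝ) / 2) *
        (1 + binEnt ((k : ℝ) / n) - binEnt ((x : ℝ) / n) +
          (1 / (n : ℝ)) * Real.logb 2 ((n : ℝ) + 1))) := by
  have hn0 : (0 : ℝ) < n := by exact_mod_cast hn
  refine abs_lt_of_sq_lt_sq ?_ (by positivity)
  have hsq : ((2 : ℝ) ^ (((n : ℝ) / 2) * (1 + binEnt ((k : ℝ) / n) - binEnt ((x : ℝ) / n) +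
      (1 / (n : ℝ)) * Real.logb 2 ((n : ℝ) + 1)))) ^ 2 =
      2 ^ n * (2 : ℝ) ^ ((n : ℝ) * binEnt ((k : ℝ) / n)) /
        (2 : ℝ) ^ ((n : ℝ) * binEnt ((x : ℝ) / n)) * (n + 1) := by
    have hlog : (2 : ℝ) ^ Real.logb 2 ((n : ℝ) + 1) = n + 1 :=
      Real.rpow_logb (by norm_num) (by norm_num) (by positivity)
    rw [← Real.rpow_mul_natCast (by norm_num)]
    conv_rhs => rw [← hlog, ← Real.rpow_natCast 2 n, ← Real.rpow_add (by norm_num),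
      ← Real.rpow_sub (by norm_num), ← Real.rpow_add (by norm_num)]
    congr 1
    push_cast
    field_simp
  rw [hsq, two_rpow_mul_binEnt hn hk, two_rpow_mul_binEnt hn hx]
  have hposk : (0 : ℝ) < ((k ^ k * (n - k) ^ (n - k) : ℕ) : ℝ) := by
    exact_mod_cast Nat.mul_pos Nat.pow_self_pos Nat.pow_self_pos
  have hposx : (0 : ℝ) < ((x ^ x * (n - x) ^ (n - x) : ℕ) : ℝ) := by
    exact_mod_cast Nat.mul_pos Nat.pow_self_pos Nat.pow_self_pos
  have hup : (n.choose k : ℝ) * ((k ^ k * (n - k) ^ (n - k) : ℕ) : ℝ) ≤ (n : ℝ) ^ n := by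
    exact_mod_cast choose_mul_pow_self_le hk
  have hlow : (n : ℝ) ^ n <
      (n + 1) * ((n.choose x : ℝ) * ((x ^ x * (n - x) ^ (n - x) : ℕ) : ℝ)) := by
    exact_mod_cast pow_self_lt_succ_mul_choose hn hx
  have hcx : (0 : ℝ) < n.choose x := by exact_mod_cast Nat.choose_pos hx
  have hck : (0 : ℝ) < n.choose k := by exact_mod_cast Nat.choose_pos hk
  generalize ((k ^ k * (n - k) ^ (n - k) : ℕ) : ℝ) = A at *
  generalize ((x ^ x * (n - x) ^ (n - x) : ℕ) : ℝ) = B at *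
  have hkraw := choose_mul_kraw_sq_le hk hx
  calc kraw n k (x : ℝ) ^ 2 ≤ 2 ^ n * (n.choose k : ℝ) / n.choose x := by
        rw [le_div_iff₀ hcx]; linarith
    _ ≤ 2 ^ n * ((n : ℝ) ^ n / A) / n.choose x := by
        gcongr
        rwa [le_div_iff₀ hposk]
    _ < 2 ^ n * ((n : ℝ) ^ n / A) * ((n + 1) * B / (n : ℝ) ^ n) := by
        rw [div_eq_mul_inv _ (n.choose x : ℝ)]
        gcongr
        rw [lt_div_iff₀ (by positivity), inv_mul_lt_iff₀ hcx]
        linarith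
    _ = _ := by field_simp
end
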